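/- In a finite two-player zero-sum game, if μ is an (exact) coarse correlated equilibrium, then the marginal strategy profile s^μ is a Nash equilibrium: for each player i and every mixed strategy s′_i of player i, u_i(s′_i, s^μ_{−i}) ≤ u_i(s^μ). -/

import Mathlib

open Finset

/-- A probability distribution on a finite type, represented as a nonnegative
real-valued function summing to one. -/
def IsDist {α : Type*} [Fintype α] (p : α → ℝ) : Prop :=
  (∀ x, 0 ≤ p x) ∧ ∑ x, p x = 1

/-- The marginal of a joint distribution `μ` on the first player's pure strategies. -/
def marg1 {P₁ P₂ : Type*} [Fintype P₁] [Fintype P₂] (μ : P₁ × P₂ → ℝ) : P₁ → ℝ :=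
  fun a => ∑ b, μ (a, b)

/-- The marginal of a joint distribution `μ` on the second player's pure strategies. -/
def marg2 {P₁ P₂ : Type*} [Fintype P₁] [Fintype P₂] (μ : P₁ × P₂ → ℝ) : P₂ → ℝ :=
  fun b => ∑ a, μ (a, b)

/-- Expected utility when the players independently play mixed strategies `s₁` and `s₂`. -/
def mixedU {P₁ P₂ : Type*} [Fintype P₁] [Fintype P₂]
    (u : P₁ × P₂ → ℝ) (s₁ : P₁ → ℝ) (s₂ : P₂ → ℝ) : ℝ :=
  ∑ a, ∑ b, s₁ a * s₂ b * u (a, b)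

/-- Expected utility when player 1 plays mixed strategy `s₁` and player 2 plays
the pure strategy `b`. -/
def mixedU1 {P₁ P₂ : Type*} [Fintype P₁] [Fintype P₂]
    (u : P₁ × P₂ → ℝ) (s₁ : P₁ → ℝ) (b : P₂) : ℝ :=
  ∑ a, s₁ a * u (a, b)

/-- Expected utility when player 1 plays the pure strategy `a` and player 2 plays
mixed strategy `s₂`. -/
def mixedU2 {P₁ P₂ : Type*} [Fintype P₁] [Fintype P₂]
    (u : P₁ × P₂ → ℝ) (a : P₁) (s₂ : P₂ → ℝ) : ℝ :=
  ∑ b, s₂ b * u (a, b)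

/-- Expectation of `f(ρ)` for `ρ ~ μ`, `μ` a joint distribution over pure strategy profiles. -/
def expect {P₁ P₂ : Type*} [Fintype P₁] [Fintype P₂]
    (μ : P₁ × P₂ → ℝ) (f : P₁ × P₂ → ℝ) : ℝ :=
  ∑ ρ, μ ρ * f ρ

/-- `μ` is an ε-coarse correlated equilibrium of the two-player game with utilities
`u₁, u₂`: no player can gain more than `ε` in expectation by deviating to any fixed
mixed strategy while the opponent's pure strategy is drawn from `μ`. -/
def IsCCE {P₁ P₂ : Type*} [Fintype P₁] [Fintype P₂]
    (ε : ℝ) (u₁ u₂ : P₁ × P₂ → ℝ) (μ : P₁ × P₂ → ℝ) : Prop :=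
  (∀ s₁' : P₁ → ℝ, IsDist s₁' → expect μ (fun ρ => mixedU1 u₁ s₁' ρ.2 - u₁ ρ) ≤ ε) ∧
  (∀ s₂' : P₂ → ℝ, IsDist s₂' → expect μ (fun ρ => mixedU2 u₂ ρ.1 s₂' - u₂ ρ) ≤ ε)

theorem IsDist.marg1 {P₁ P₂ : Type*} [Fintype P₁] [Fintype P₂] {μ : P₁ × P₂ → ℝ}
    (hμ : IsDist μ) : IsDist (marg1 μ) :=
  ⟨fun _ => sum_nonneg fun _ _ => hμ.1 _, by
    rw [← hμ.2, Fintype.sum_prod_type]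
    rfl⟩

theorem IsDist.marg2 {P₁ P₂ : Type*} [Fintype P₁] [Fintype P₂] {μ : P₁ × P₂ → ℝ}
    (hμ : IsDist μ) : IsDist (marg2 μ) :=
  ⟨fun _ => sum_nonneg fun _ _ => hμ.1 _, by
    rw [← hμ.2, Fintype.sum_prod_type_right]
    rfl⟩

theorem expect_sub {P₁ P₂ : Type*} [Fintype P₁] [Fintype P₂] (μ f g : P₁ × P₂ → ℝ) :
    expect μ (fun ρ => f ρ - g ρ) = expect μ f - expect μ g := by
  simp only [_root_.expect, mul_sub, sum_sub_distrib]

theorem expect_mixedU1 {P₁ P₂ : Type*} [Fintype P₁] [Fintype P₂]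
    (μ u : P₁ × P₂ → ℝ) (s₁ : P₁ → ℝ) :
    expect μ (fun ρ => mixedU1 u s₁ ρ.2) = mixedU u s₁ (marg2 μ) := by
  simp only [_root_.expect, mixedU1, mixedU, marg2]
  rw [Fintype.sum_prod_type_right, sum_comm (s := (univ : Finset P₁))]
  refine sum_congr rfl fun b _ => ?_
  dsimp only
  rw [← sum_mul, mul_sum]
  exact sum_congr rfl fun a _ => by ring

theorem expect_mixedU2 {P₁ P₂ : Type*} [Fintype P₁] [Fintype P₂]
    (μ u : P₁ × P₂ → ℝ) (s₂ : P₂ → ℝ) :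
    expect μ (fun ρ => mixedU2 u ρ.1 s₂) = mixedU u (marg1 μ) s₂ := by
  simp only [_root_.expect, mixedU2, mixedU, marg1]
  rw [Fintype.sum_prod_type]
  refine sum_congr rfl fun a _ => ?_
  dsimp only
  rw [← sum_mul, mul_sum]
  exact sum_congr rfl fun b _ => by ring

/-- in a finite two-player zero-sum game, if `μ` is an exact CCE then the
marginal strategy profile is a Nash equilibrium: no player can strictly increase their
expected utility by unilaterally deviating to any mixed strategy. -/
theorem cce_marginals_nash {P₁ P₂ : Type*} [Fintype P₁] [Fintype P₂]
    [Nonempty P₁] [Nonempty P₂]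
    (u₁ u₂ : P₁ × P₂ → ℝ) (hzs : ∀ ρ : P₁ × P₂, u₁ ρ + u₂ ρ = 0)
    (μ : P₁ × P₂ → ℝ) (hμ : IsDist μ)
    (hcce : IsCCE 0 u₁ u₂ μ) :
    (∀ s₁' : P₁ → ℝ, IsDist s₁' →
      mixedU u₁ s₁' (marg2 μ) ≤ mixedU u₁ (marg1 μ) (marg2 μ)) ∧
    (∀ s₂' : P₂ → ℝ, IsDist s₂' →
      mixedU u₂ (marg1 μ) s₂' ≤ mixedU u₂ (marg1 μ) (marg2 μ)) := by
  obtain ⟨h₁, h₂⟩ := hcce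
  simp only [expect_sub, expect_mixedU1, expect_mixedU2, sub_nonpos] at h₁ h₂
  obtain rfl : u₂ = fun ρ => -u₁ ρ := funext fun ρ => by linarith [hzs ρ]
  have hE : expect μ (fun ρ => -u₁ ρ) = -expect μ u₁ := by simp [_root_.expect]
  have hU : mixedU (fun ρ => -u₁ ρ) (marg1 μ) (marg2 μ) = -mixedU u₁ (marg1 μ) (marg2 μ) := by
    simp [mixedU]
  have hle := h₁ _ hμ.marg1
  have hge := h₂ _ hμ.marg2
  exact ⟨fun s hs => by linarith [h₁ s hs], fun s hs => by linarith [h₂ s hs]⟩
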